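/- Let a = (a_n) ∈ (0,1)^ℕ be such that the set {n ∈ ℕ : a_n > 1/3} is infinite, and let k_0 ∈ ℕ∪{0} be such that a_{k_0+1} < 1/3. If condition (*) holds (i.e., m_n ≥ 2·∑_{i=n+1}^∞ (d_{k_i−1} − d_{k_i}) for every n ∈ ℕ), then the difference set C(a) − C(a) is a Cantorval. -/

import Mathlib

open Pointwise MeasureTheory

namespace CCS

/-- `dSeq a n` is the common length `d_n = ∏_{i=1}^n (1 - a_i)/2` of the intervals of the
`n`-th step of the construction of the central Cantor set `C(a)` (`d_0 = 1`).
The sequence `a` is indexed from `1`; the value `a 0` is irrelevant. -/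
noncomputable def dSeq (a : ℕ → ℝ) (n : ℕ) : ℝ :=
  ∏ i ∈ Finset.Icc 1 n, ((1 - a i) / 2)

/-- Left endpoint of the interval `I_t`, `t ∈ {0,1}^n` (coded as a list, the paper's
`t_j` being `t.getD (j-1) 0`): `l(I_t) = ∑_{j=1}^n t_j (d_{j-1} - d_j)`. -/
noncomputable def Il (a : ℕ → ℝ) (t : List ℕ) : ℝ :=
  ∑ j ∈ Finset.range t.length, (t.getD j 0 : ℝ) * (dSeq a j - dSeq a (j + 1))

/-- The `n`-th step `C_n(a)` of the construction of the central Cantor set: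
the union of the intervals `I_t = [l(I_t), l(I_t) + d_n]` over `t ∈ {0,1}^n`. -/
noncomputable def cantorStep (a : ℕ → ℝ) (n : ℕ) : Set ℝ :=
  ⋃ t ∈ {t : List ℕ | t.length = n ∧ ∀ j ∈ t, j ≤ 1},
    Set.Icc (Il a t) (Il a t + dSeq a n)

/-- The central Cantor set `C(a) = ⋂ₙ C_n(a)`. -/
noncomputable def cantorSet (a : ℕ → ℝ) : Set ℝ := ⋂ n, cantorStep a n

/-- Left endpoint of the interval `J_s = I_t - I_p`, for `s ∈ {0,1,2}^n`:
`l(J_s) = -1 + ∑_{j=1}^n s_j (d_{j-1} - d_j)`. -/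
noncomputable def Jl (a : ℕ → ℝ) (s : List ℕ) : ℝ :=
  -1 + ∑ j ∈ Finset.range s.length, (s.getD j 0 : ℝ) * (dSeq a j - dSeq a (j + 1))

/-- Right endpoint of `J_s`: `r(J_s) = l(J_s) + 2 d_n`. -/
noncomputable def Jr (a : ℕ → ℝ) (s : List ℕ) : ℝ :=
  Jl a s + 2 * dSeq a s.length

/-- The interval `J_s`. -/
noncomputable def Jset (a : ℕ → ℝ) (s : List ℕ) : Set ℝ := Set.Icc (Jl a s) (Jr a s)

/-- Left endpoint of the gap `G^i_s` (`i = 0`: left gap, `i = 1`: right gap) of `J_s`. -/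
noncomputable def Gl (a : ℕ → ℝ) (i : ℕ) (s : List ℕ) : ℝ :=
  Jl a s + (i : ℝ) * (dSeq a s.length - dSeq a (s.length + 1)) + 2 * dSeq a (s.length + 1)

/-- Right endpoint of the gap `G^i_s`. -/
noncomputable def Gr (a : ℕ → ℝ) (i : ℕ) (s : List ℕ) : ℝ :=
  Jl a s + ((i : ℝ) + 1) * (dSeq a s.length - dSeq a (s.length + 1))

/-- The gap `G^i_s ⊆ J_s`, an open interval. -/
noncomputable def Gset (a : ℕ → ℝ) (i : ℕ) (s : List ℕ) : Set ℝ :=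
  Set.Ioo (Gl a i s) (Gr a i s)

/-- `N(0,s) = max {j : s_j > 0}`, `N(1,s) = max {j : s_j < 2}` (1-based, `max ∅ = 0`). -/
noncomputable def Nidx (i : ℕ) (s : List ℕ) : ℕ :=
  sSup {j | 1 ≤ j ∧ j ≤ s.length ∧
    (if i = 0 then 0 < s.getD (j - 1) 0 else s.getD (j - 1) 0 < 2)}

/-- The family `𝒢^{i0}_{s0}(n)` of (indices of) gaps of rank `n`, for
`s0 ∈ {0,1,2}^{k_m - 1}`; a gap `G^i_s` is coded by the pair `(i, s)`.
`𝒢^{i0}_{s0}(m) = {G^{i0}_{s0}}` and for `n > m`,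
`𝒢^{i0}_{s0}(n)` consists of the gap `Ḡ^{i0}_{s0}(n)` together with the gaps
`Ḡ^1_{t^j}(n)`, `Ḡ^0_{t^(j+1)}(n)` for all `G^j_t ∈ 𝒢^{i0}_{s0}(l)`, `m ≤ l < n`. -/
def gapFamily (k : ℕ → ℕ) (i0 : ℕ) (s0 : List ℕ) (m : ℕ) (n : ℕ) : Set (ℕ × List ℕ) :=
  if n ≤ m then {(i0, s0)}
  else
    {(i0, s0 ++ List.replicate (k n - k m) (2 * i0))} ∪
      ⋃ (l : ℕ) (_ : m ≤ l) (hl : l < n),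
        ⋃ p ∈ gapFamily k i0 s0 m l,
          ({(1, p.2 ++ p.1 :: List.replicate (k n - k l - 1) 2),
            (0, p.2 ++ (p.1 + 1) :: List.replicate (k n - k l - 1) 0)} : Set (ℕ × List ℕ))
termination_by n
decreasing_by exact hl

/-- The family `𝒢^{i0}_{s0} = ⋃_{n ≥ m} 𝒢^{i0}_{s0}(n)`. -/
def gapFamilyAll (k : ℕ → ℕ) (i0 : ℕ) (s0 : List ℕ) (m : ℕ) : Set (ℕ × List ℕ) :=
  ⋃ (n : ℕ) (_ : m ≤ n), gapFamily k i0 s0 m n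

/-- The family `𝒢_t := 𝒢^0_{t ++ 0^{(k_m - |t| - 1)}} ∪ 𝒢^1_{t ++ 2^{(k_m - |t| - 1)}}`
for `t ∈ {0,1,2}^k` with `k_{m-1} ≤ k < k_m`. -/
def gapFamilyT (k : ℕ → ℕ) (m : ℕ) (t : List ℕ) : Set (ℕ × List ℕ) :=
  gapFamilyAll k 0 (t ++ List.replicate (k m - t.length - 1) 0) m ∪
    gapFamilyAll k 1 (t ++ List.replicate (k m - t.length - 1) 2) m

/-- The union `⋃ 𝒢` of a family of (indices of) gaps, as a subset of `ℝ`. -/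
noncomputable def gapUnion (a : ℕ → ℝ) (G : Set (ℕ × List ℕ)) : Set ℝ :=
  ⋃ p ∈ G, Gset a p.1 p.2

/-- `padSeq k c s m n` is the index of the gap `G^i(s,n)` (for `c = 2i`):
`s ++ c^{(k_m - |s| - 1)} ++ 1 ++ c^{(k_{m+1} - k_m - 1)} ++ 1 ++ ⋯ ++ 1 ++ c^{(k_n - k_{n-1} - 1)}`. -/
def padSeq (k : ℕ → ℕ) (c : ℕ) (s : List ℕ) (m : ℕ) : ℕ → List ℕ
  | 0 => s ++ List.replicate (k m - s.length - 1) c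
  | n + 1 =>
    if n + 1 ≤ m then s ++ List.replicate (k m - s.length - 1) c
    else padSeq k c s m n ++ 1 :: List.replicate (k (n + 1) - k n - 1) c

/-- `δ_n := min {3d_i - d_{i-1} : k_{n-1} + 1 ≤ i ≤ k_n - 1}` (as an element of `EReal`,
so that `min ∅ = ⊤ = ∞`). -/
noncomputable def deltaMin (a : ℕ → ℝ) (k : ℕ → ℕ) (n : ℕ) : EReal :=
  sInf ((fun i => ((3 * dSeq a i - dSeq a (i - 1) : ℝ) : EReal)) ''
    (Set.Icc (k (n - 1) + 1) (k n - 1)))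

/-- `Δ_n := max {3d_i - d_{i-1} : k_{n-1} + 1 ≤ i ≤ k_n - 1}` (`max ∅ = ⊥ = -∞`). -/
noncomputable def deltaMax (a : ℕ → ℝ) (k : ℕ → ℕ) (n : ℕ) : EReal :=
  sSup ((fun i => ((3 * dSeq a i - dSeq a (i - 1) : ℝ) : EReal)) ''
    (Set.Icc (k (n - 1) + 1) (k n - 1)))

/-- `m_n := min { δ_n - (d_{k_n - 1} - d_{k_n}), 4 d_{k_n} - Δ_n }`. -/
noncomputable def mSeq (a : ℕ → ℝ) (k : ℕ → ℕ) (n : ℕ) : EReal :=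
  min (deltaMin a k n - ((dSeq a (k n - 1) - dSeq a (k n) : ℝ) : EReal))
    (((4 * dSeq a (k n) : ℝ) : EReal) - deltaMax a k n)

/-- `∑_{i=n+1}^∞ (d_{k_i - 1} - d_{k_i})`. -/
noncomputable def tailSum (a : ℕ → ℝ) (k : ℕ → ℕ) (n : ℕ) : ℝ :=
  ∑' i : ℕ, (dSeq a (k (n + 1 + i) - 1) - dSeq a (k (n + 1 + i)))

/-- Condition `(*)`: `m_n ≥ 2 ∑_{i=n+1}^∞ (d_{k_i - 1} - d_{k_i})` for every `n ∈ ℕ`. -/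
def condStar (a : ℕ → ℝ) (k : ℕ → ℕ) : Prop :=
  ∀ n : ℕ, 1 ≤ n → ((2 * tailSum a k n : ℝ) : EReal) ≤ mSeq a k n

/-- `(k_n)_{n ≥ 1}` is the increasing enumeration of all indices greater than `k 0 = k₀`
at which `a` exceeds `1/3`. -/
def IsGapEnum (a : ℕ → ℝ) (k : ℕ → ℕ) : Prop :=
  StrictMono k ∧ (∀ n, 1 ≤ n → k 0 < k n ∧ 1 / 3 < a (k n)) ∧
    (∀ j, k 0 < j → 1 / 3 < a j → ∃ n, 1 ≤ n ∧ k n = j)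

/-- `G` is a gap of `E`: a bounded connected component of `ℝ ∖ E`. -/
def IsGapOf (E G : Set ℝ) : Prop :=
  (∃ x ∉ E, G = connectedComponentIn Eᶜ x) ∧ Bornology.IsBounded G

/-- `C` is a proper (nontrivial) connected component of `E`. -/
def IsProperComponentOf (E C : Set ℝ) : Prop :=
  (∃ x ∈ E, C = connectedComponentIn E x) ∧ C.Nontrivial

/-- `E` is a Cantorval: a perfect set with infinitely many gaps such that both endpoints
of every gap are accumulated both by gaps and by proper components of `E`. -/
def IsCantorval (E : Set ℝ) : Prop :=
  Perfect E ∧ {G : Set ℝ | IsGapOf E G}.Infinite ∧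
    ∀ G, IsGapOf E G → ∀ p, p = sInf G ∨ p = sSup G →
      (∀ ε > 0, ∃ G', IsGapOf E G' ∧ G' ≠ G ∧ G' ⊆ Set.Ioo (p - ε) (p + ε)) ∧
      (∀ ε > 0, ∃ C, IsProperComponentOf E C ∧ C ⊆ Set.Ioo (p - ε) (p + ε))

/-- `J_s` and `J_u` (of length `k_m - 1`) are associated:
`N := N(0,s) = N(1,u) ∈ {k_{m-1}+1, …, k_m - 1}`, `s|(N-1) = u|(N-1)`, `u_N = s_N - 1`.
Then `J_u` is the interval covering `𝒢^0_s` and `J_s` is the interval covering `𝒢^1_u`. -/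
def Associated (k : ℕ → ℕ) (m : ℕ) (s u : List ℕ) : Prop :=
  s.length = k m - 1 ∧ u.length = k m - 1 ∧
    Nidx 0 s = Nidx 1 u ∧
    k (m - 1) + 1 ≤ Nidx 0 s ∧ Nidx 0 s ≤ k m - 1 ∧
    s.take (Nidx 0 s - 1) = u.take (Nidx 0 s - 1) ∧
    u.getD (Nidx 0 s - 1) 0 = s.getD (Nidx 0 s - 1) 0 - 1

/-- `G^i_g ⊂_* J_v`: the gap `G^i_g` is covered by the interval `J_v`, i.e. `G^i_g`
belongs to a family `𝒢^0_w` (resp. `𝒢^1_w`) such that `J_v` is the interval covering it. -/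
def CoversGap (k : ℕ → ℕ) (i : ℕ) (g : List ℕ) (v : List ℕ) : Prop :=
  ∃ m w, 1 ≤ m ∧
    ((Associated k m w v ∧ (i, g) ∈ gapFamilyAll k 0 w m) ∨
      (Associated k m v w ∧ (i, g) ∈ gapFamilyAll k 1 w m))

/-- The achievement set `E(x) = {∑_{j ∈ A} x_j : A ⊆ ℕ}` of a series (indexed from `1`). -/
def achievementSet (x : ℕ → ℝ) : Set ℝ :=
  {y | ∃ A : Set ℕ, A ⊆ {n | 1 ≤ n} ∧ HasSum (A.indicator x) y}

/-! ### Basic facts on the sequence `d_n` -/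

theorem dSeq_succ (a : ℕ → ℝ) (n : ℕ) :
    dSeq a (n + 1) = dSeq a n * ((1 - a (n + 1)) / 2) := by
  unfold dSeq
  rw [Finset.prod_Icc_succ_top (by omega)]

theorem dSeq_zero (a : ℕ → ℝ) : dSeq a 0 = 1 := by simp [dSeq]

section
variable {a : ℕ → ℝ}

theorem dSeq_pos (ha : ∀ n, 1 ≤ n → 0 < a n ∧ a n < 1)
    (n : ℕ) : 0 < dSeq a n := by
  unfold dSeq
  apply Finset.prod_pos
  intro i hi
  have := ha i (Finset.mem_Icc.1 hi).1
  linarith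

theorem dSeq_half (ha : ∀ n, 1 ≤ n → 0 < a n ∧ a n < 1)
    (n : ℕ) : 2 * dSeq a (n + 1) < dSeq a n := by
  rw [dSeq_succ]
  have h1 := dSeq_pos ha n
  have h2 := ha (n + 1) (by omega)
  nlinarith

theorem dSeq_le (ha : ∀ n, 1 ≤ n → 0 < a n ∧ a n < 1)
    (n : ℕ) : dSeq a n ≤ (1 / 2) ^ n := by
  induction n with
  | zero => simp [dSeq_zero]
  | succ n ih =>
    have := dSeq_half ha n
    rw [pow_succ]; linarith

theorem dSeq_tendsto (ha : ∀ n, 1 ≤ n → 0 < a n ∧ a n < 1)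
    : Filter.Tendsto (dSeq a) Filter.atTop (nhds 0) :=
  squeeze_zero (fun n => (dSeq_pos ha n).le) (dSeq_le ha)
    (tendsto_pow_atTop_nhds_zero_of_lt_one (by norm_num) (by norm_num))

theorem dSeq_lt_of_lt (ha : ∀ n, 1 ≤ n → 0 < a n ∧ a n < 1)
    : StrictAnti (dSeq a) :=
  strictAnti_nat_of_succ_lt fun n => by
    have := dSeq_half ha n
    have := dSeq_pos ha (n + 1)
    linarith

end

/-- The step `e_n = d_n - d_{n+1}`. -/
noncomputable def eSeq (a : ℕ → ℝ) (n : ℕ) : ℝ := dSeq a n - dSeq a (n + 1)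

/-- tail term -/
noncomputable def tTerm (a : ℕ → ℝ) (n : ℕ) (t : ℕ → Bool) (j : ℕ) : ℝ :=
  if t j then eSeq a (n + j) else 0

/-- The tail sets of the central Cantor set. -/
def Tset (a : ℕ → ℝ) (n : ℕ) : Set ℝ := Set.range fun t : ℕ → Bool => ∑' j, tTerm a n t j

section
variable {a : ℕ → ℝ}

theorem eSeq_pos (ha : ∀ n, 1 ≤ n → 0 < a n ∧ a n < 1)
    (n : ℕ) : 0 < eSeq a n := sub_pos.2 (dSeq_lt_of_lt ha (Nat.lt_succ_self n))

theorem eSeq_succ_le (ha : ∀ n, 1 ≤ n → 0 < a n ∧ a n < 1)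
    (n : ℕ) : eSeq a (n + 1) ≤ eSeq a n := by
  unfold eSeq
  have := dSeq_half ha n
  have := dSeq_pos ha (n + 1 + 1)
  linarith

theorem eSeq_anti (ha : ∀ n, 1 ≤ n → 0 < a n ∧ a n < 1)
    : Antitone (eSeq a) := antitone_nat_of_succ_le (eSeq_succ_le ha)

theorem eSeq_hasSum (ha : ∀ n, 1 ≤ n → 0 < a n ∧ a n < 1)
    (n : ℕ) : HasSum (fun j => eSeq a (n + j)) (dSeq a n) := by
  rw [hasSum_iff_tendsto_nat_of_nonneg (fun j => (eSeq_pos ha _).le)]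
  have h : ∀ m, ∑ j ∈ Finset.range m, eSeq a (n + j) = dSeq a n - dSeq a (n + m) := by
    intro m
    have := Finset.sum_range_sub' (fun j => dSeq a (n + j)) m
    simpa [eSeq, add_assoc] using this
  simp_rw [h]
  have := (dSeq_tendsto ha).comp (Filter.tendsto_add_atTop_nat n)
  have h2 : Filter.Tendsto (fun m => dSeq a (n + m)) Filter.atTop (nhds 0) := by
    refine this.congr fun m => ?_
    simp [add_comm]
  simpa using tendsto_const_nhds.sub h2

theorem tTerm_nonneg (ha : ∀ n, 1 ≤ n → 0 < a n ∧ a n < 1)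
    (n : ℕ) (t : ℕ → Bool) (j : ℕ) : 0 ≤ tTerm a n t j := by
  unfold tTerm
  split_ifs
  · exact (eSeq_pos ha _).le
  · exact le_rfl

theorem tTerm_le (ha : ∀ n, 1 ≤ n → 0 < a n ∧ a n < 1)
    (n : ℕ) (t : ℕ → Bool) (j : ℕ) : tTerm a n t j ≤ eSeq a (n + j) := by
  unfold tTerm
  split_ifs
  · exact le_rfl
  · exact (eSeq_pos ha _).le

theorem tTerm_summable (ha : ∀ n, 1 ≤ n → 0 < a n ∧ a n < 1)
    (n : ℕ) (t : ℕ → Bool) : Summable (tTerm a n t) :=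
  Summable.of_nonneg_of_le (tTerm_nonneg ha n t) (tTerm_le ha n t) (eSeq_hasSum ha n).summable

theorem Tset_compact (ha : ∀ n, 1 ≤ n → 0 < a n ∧ a n < 1)
    (n : ℕ) : IsCompact (Tset a n) := by
  apply isCompact_range
  refine continuous_tsum (u := fun j => eSeq a (n + j)) (fun j => ?_) (eSeq_hasSum ha n).summable
    (fun j t => ?_)
  · unfold tTerm
    have : Continuous (fun b : Bool => if b then eSeq a (n + j) else 0) :=
      continuous_of_discreteTopology
    exact this.comp (continuous_apply j)
  · rw [Real.norm_of_nonneg (tTerm_nonneg ha n t j)]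
    exact tTerm_le ha n t j

theorem Tset_subset (ha : ∀ n, 1 ≤ n → 0 < a n ∧ a n < 1)
    (n : ℕ) : Tset a n ⊆ Set.Icc 0 (dSeq a n) := by
  rintro x ⟨t, rfl⟩
  refine ⟨tsum_nonneg (tTerm_nonneg ha n t), ?_⟩
  rw [← (eSeq_hasSum ha n).tsum_eq]
  exact (tTerm_summable ha n t).tsum_le_tsum (tTerm_le ha n t) (eSeq_hasSum ha n).summable

theorem zero_mem_Tset (n : ℕ) : 0 ∈ Tset a n := ⟨fun _ => false, by simp [tTerm]⟩

theorem d_mem_Tset (ha : ∀ n, 1 ≤ n → 0 < a n ∧ a n < 1)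
    (n : ℕ) : dSeq a n ∈ Tset a n :=
  ⟨fun _ => true, by simpa [tTerm] using (eSeq_hasSum ha n).tsum_eq⟩

theorem mem_Tset_iff (ha : ∀ n, 1 ≤ n → 0 < a n ∧ a n < 1)
    (n : ℕ) (x : ℝ) :
    x ∈ Tset a n ↔ x ∈ Tset a (n + 1) ∨ x - eSeq a n ∈ Tset a (n + 1) := by
  constructor
  · rintro ⟨t, rfl⟩
    have h := (tTerm_summable ha n t).tsum_eq_zero_add
    have h2 : ∀ j, tTerm a n t (j + 1) = tTerm a (n + 1) (fun i => t (i + 1)) j := by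
      intro j
      simp only [tTerm, show n + (j + 1) = n + 1 + j by ring]
    simp_rw [h2] at h
    simp only [h]
    cases ht : t 0
    · left
      exact ⟨fun i => t (i + 1), by simp [tTerm, ht]⟩
    · right
      exact ⟨fun i => t (i + 1), by simp [tTerm, ht]⟩
  · have key : ∀ (b : Bool) (t : ℕ → Bool),
        (if b then eSeq a n else 0) + ∑' j, tTerm a (n + 1) t j ∈ Tset a n := by
      intro b t
      refine ⟨fun i => Nat.casesOn i b t, ?_⟩
      simp only
      rw [(tTerm_summable ha n _).tsum_eq_zero_add]
      congr 1
      apply tsum_congr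
      intro j
      simp only [tTerm, show n + (j + 1) = n + 1 + j by ring]
    rintro (⟨t, ht⟩ | ⟨t, ht⟩)
    · have := key false t
      simp only at ht
      rw [ht] at this
      simpa using this
    · have := key true t
      simp only at ht
      rw [ht] at this
      simpa using this

end
section
variable {a : ℕ → ℝ}

/-- finite sums of the steps, followed by a tail, lie in the tail set of level `0` -/
theorem fin_add_mem (ha : ∀ n, 1 ≤ n → 0 < a n ∧ a n < 1)
    (n : ℕ) (c : ℕ → Bool) (y : ℝ) (hy : y ∈ Tset a n) :
    (∑ j ∈ Finset.range n, if c j then eSeq a j else 0) + y ∈ Tset a 0 := by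
  induction n generalizing y with
  | zero => simpa using hy
  | succ n ih =>
    rw [Finset.sum_range_succ, add_assoc]
    apply ih
    rw [mem_Tset_iff ha]
    cases c n
    · left; simpa using hy
    · right; simpa using hy

theorem cantorSet_eq (ha : ∀ n, 1 ≤ n → 0 < a n ∧ a n < 1)
    : cantorSet a = Tset a 0 := by
  apply Set.Subset.antisymm
  · intro x hx
    have hcl := (Tset_compact ha 0).isClosed
    rw [← hcl.closure_eq, Metric.mem_closure_iff]
    intro ε hε
    obtain ⟨n, hn⟩ := ((dSeq_tendsto ha).eventually (gt_mem_nhds hε)).exists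
    have := Set.mem_iInter.1 hx n
    simp only [cantorStep, Set.mem_iUnion, Set.mem_ofPred_eq] at this
    obtain ⟨t, ⟨hl, ht⟩, h1, h2⟩ := this
    refine ⟨Il a t, ?_, ?_⟩
    · have := fin_add_mem ha n (fun j => t.getD j 0 = 1) 0 (zero_mem_Tset n)
      convert this using 1
      rw [add_zero, Il, hl]
      apply Finset.sum_congr rfl
      intro j hj
      have hj' : j < t.length := by rw [hl]; exact Finset.mem_range.1 hj
      have hle := ht _ (List.getElem_mem hj')
      rw [List.getD_eq_getElem _ _ hj']
      interval_cases h : t[j] <;> simp [eSeq]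
    · rw [Real.dist_eq, abs_lt]
      constructor <;> linarith
  · intro x hx
    rw [cantorSet, Set.mem_iInter]
    intro n
    obtain ⟨t, rfl⟩ := hx
    simp only [cantorStep, Set.mem_iUnion, Set.mem_ofPred_eq]
    refine ⟨(List.range n).map (fun j => if t j then 1 else 0), ⟨by simp, ?_⟩, ?_⟩
    · intro j hj
      simp only [List.mem_map] at hj
      obtain ⟨i, _, rfl⟩ := hj
      split_ifs <;> simp
    · have h1 : Il a ((List.range n).map (fun j => if t j then 1 else 0))
          = ∑ j ∈ Finset.range n, tTerm a 0 t j := by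
        simp only [Il, List.length_map, List.length_range]
        apply Finset.sum_congr rfl
        intro j hj
        have hj := Finset.mem_range.1 hj
        rw [List.getD_eq_getElem _ _ (by simpa using hj)]
        by_cases h : t j <;> simp [tTerm, eSeq, h]
      have h2 := (tTerm_summable ha 0 t).sum_add_tsum_nat_add n
      have h3 : ∑' j, tTerm a 0 t (j + n) ∈ Tset a n :=
        ⟨fun j => t (j + n), by simp [tTerm, add_comm]⟩
      have h4 := Tset_subset ha n h3
      rw [h1]
      rw [← h2]
      exact ⟨by linarith [h4.1], by linarith [h4.2]⟩

end

/-- The tail difference sets. -/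
def Kset (a : ℕ → ℝ) (n : ℕ) : Set ℝ := Tset a n - Tset a n

section
variable {a : ℕ → ℝ}

theorem Kset_compact (ha : ∀ n, 1 ≤ n → 0 < a n ∧ a n < 1)
    (n : ℕ) : IsCompact (Kset a n) :=
  by simpa only [Kset, sub_eq_add_neg] using (Tset_compact ha n).add (Tset_compact ha n).neg

theorem Kset_closed (ha : ∀ n, 1 ≤ n → 0 < a n ∧ a n < 1)
    (n : ℕ) : IsClosed (Kset a n) := (Kset_compact ha n).isClosed

theorem Kset_bd (ha : ∀ n, 1 ≤ n → 0 < a n ∧ a n < 1)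
    {n : ℕ} {x : ℝ} (hx : x ∈ Kset a n) : -dSeq a n ≤ x ∧ x ≤ dSeq a n := by
  obtain ⟨u, hu, v, hv, rfl⟩ := Set.mem_sub.1 hx
  have := Tset_subset ha n hu
  have := Tset_subset ha n hv
  simp only [Set.mem_Icc] at *
  constructor <;> linarith

theorem Kset_neg {n : ℕ} {x : ℝ} (hx : x ∈ Kset a n) : -x ∈ Kset a n := by
  obtain ⟨u, hu, v, hv, rfl⟩ := Set.mem_sub.1 hx
  exact Set.mem_sub.2 ⟨v, hv, u, hu, by ring⟩

theorem zero_mem_Kset (n : ℕ) : (0 : ℝ) ∈ Kset a n :=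
  Set.mem_sub.2 ⟨0, zero_mem_Tset n, 0, zero_mem_Tset n, by ring⟩

theorem d_mem_Kset (ha : ∀ n, 1 ≤ n → 0 < a n ∧ a n < 1)
    (n : ℕ) : dSeq a n ∈ Kset a n :=
  Set.mem_sub.2 ⟨_, d_mem_Tset ha n, 0, zero_mem_Tset n, by ring⟩

theorem mem_Kset_iff (ha : ∀ n, 1 ≤ n → 0 < a n ∧ a n < 1)
    (n : ℕ) (x : ℝ) : x ∈ Kset a n ↔
    x ∈ Kset a (n + 1) ∨ x - eSeq a n ∈ Kset a (n + 1) ∨ x + eSeq a n ∈ Kset a (n + 1) := by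
  constructor
  · intro hx
    obtain ⟨u, hu, v, hv, rfl⟩ := Set.mem_sub.1 hx
    rw [mem_Tset_iff ha] at hu hv
    rcases hu with hu | hu <;> rcases hv with hv | hv
    · left; exact Set.sub_mem_sub hu hv
    · right; right; exact Set.mem_sub.2 ⟨_, hu, _, hv, by ring⟩
    · right; left; exact Set.mem_sub.2 ⟨_, hu, _, hv, by ring⟩
    · left; exact Set.mem_sub.2 ⟨_, hu, _, hv, by ring⟩
  · rintro (h | h | h)
    · obtain ⟨u, hu, v, hv, h⟩ := Set.mem_sub.1 h
      exact Set.mem_sub.2 ⟨u, (mem_Tset_iff ha n u).2 (Or.inl hu), v,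
        (mem_Tset_iff ha n v).2 (Or.inl hv), h⟩
    · obtain ⟨u, hu, v, hv, h⟩ := Set.mem_sub.1 h
      exact Set.mem_sub.2 ⟨u + eSeq a n, (mem_Tset_iff ha n _).2 (Or.inr (by simpa using hu)), v,
        (mem_Tset_iff ha n v).2 (Or.inl hv), by linarith⟩
    · obtain ⟨u, hu, v, hv, h⟩ := Set.mem_sub.1 h
      exact Set.mem_sub.2 ⟨u, (mem_Tset_iff ha n u).2 (Or.inl hu), v + eSeq a n,
        (mem_Tset_iff ha n _).2 (Or.inr (by simpa using hv)), by linarith⟩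

/-- Decomposition of the difference set at level `n`. -/
theorem Kset_decomp (ha : ∀ n, 1 ≤ n → 0 < a n ∧ a n < 1)
    (n : ℕ) : ∃ F : Set ℝ, F.Finite ∧
    ∀ x, x ∈ Kset a 0 ↔ ∃ f ∈ F, x - f ∈ Kset a n := by
  induction n with
  | zero => exact ⟨{0}, Set.finite_singleton 0, fun x => by simp⟩
  | succ n ih =>
    obtain ⟨F, hF, h⟩ := ih
    refine ⟨F ∪ ((fun f => f + eSeq a n) '' F ∪ (fun f => f - eSeq a n) '' F),
      hF.union ((hF.image _).union (hF.image _)), fun x => ?_⟩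
    rw [h]
    constructor
    · rintro ⟨f, hf, hx⟩
      rw [mem_Kset_iff ha] at hx
      rcases hx with hx | hx | hx
      · exact ⟨f, Or.inl hf, hx⟩
      · exact ⟨_, Or.inr (Or.inl ⟨f, hf, rfl⟩), by convert hx using 1; ring⟩
      · exact ⟨_, Or.inr (Or.inr ⟨f, hf, rfl⟩), by convert hx using 1; ring⟩
    · rintro ⟨g, hg | ⟨f, hf, rfl⟩ | ⟨f, hf, rfl⟩, hx⟩
      · exact ⟨g, hg, (mem_Kset_iff ha _ _).2 (Or.inl hx)⟩
      · exact ⟨f, hf, (mem_Kset_iff ha _ _).2 (Or.inr (Or.inl (by convert hx using 1; ring)))⟩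
      · exact ⟨f, hf, (mem_Kset_iff ha _ _).2 (Or.inr (Or.inr (by convert hx using 1; ring)))⟩

/-- The rightmost copy of `K_N` inside `K_m`. -/
theorem Kset_right (ha : ∀ n, 1 ≤ n → 0 < a n ∧ a n < 1)
    {m N : ℕ} (h : m ≤ N) {x : ℝ} (hx : x ∈ Kset a N) :
    dSeq a m - dSeq a N + x ∈ Kset a m := by
  induction N, h using Nat.le_induction generalizing x with
  | base => simpa using hx
  | succ N _ ih =>
    have : x + eSeq a N ∈ Kset a N := (mem_Kset_iff ha _ _).2 (Or.inr (Or.inl (by simpa using hx)))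
    convert ih this using 1
    unfold eSeq; ring

/-- The gap next to the right end of `K_m` coming from the index `N`. -/
theorem Kset_gap (ha : ∀ n, 1 ≤ n → 0 < a n ∧ a n < 1)
    {m N : ℕ} (h : m ≤ N) {x : ℝ} (hx : x ∈ Kset a m) :
    x ≤ dSeq a m - eSeq a N ∨ dSeq a m - 2 * dSeq a (N + 1) ≤ x := by
  induction h using Nat.decreasingInduction generalizing x with
  | self =>
    rw [mem_Kset_iff ha] at hx
    have he : eSeq a N = dSeq a N - dSeq a (N + 1) := rfl
    have := eSeq_pos ha N
    rcases hx with hx | hx | hx <;> have := Kset_bd ha hx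
    · left; linarith
    · right; linarith
    · left; linarith
  | of_succ m hm ih =>
    rw [mem_Kset_iff ha] at hx
    have he : eSeq a m = dSeq a m - dSeq a (m + 1) := rfl
    have := eSeq_pos ha m
    have := eSeq_anti ha hm.le
    rcases hx with hx | hx | hx
    · have := Kset_bd ha hx
      left; linarith
    · rcases ih hx with h | h
      · left; linarith
      · right; linarith
    · have := Kset_bd ha hx
      left; linarith

theorem Kset_interior_succ (ha : ∀ n, 1 ≤ n → 0 < a n ∧ a n < 1)
    (n : ℕ) (h : (interior (Kset a n)).Nonempty) :
    (interior (Kset a (n + 1))).Nonempty := by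
  by_contra hne
  rw [Set.not_nonempty_iff_eq_empty] at hne
  have hc := Kset_closed ha (n + 1)
  let K := Kset a (n + 1)
  have heq : Kset a n = K ∪ ((Homeomorph.subRight (eSeq a n)) ⁻¹' K ∪
      (Homeomorph.addRight (eSeq a n)) ⁻¹' K) := by
    ext x
    exact mem_Kset_iff ha n x
  have h1 : interior ((Homeomorph.subRight (eSeq a n)) ⁻¹' K) = ∅ := by
    rw [← Homeomorph.preimage_interior, hne, Set.preimage_empty]
  have h2 : interior ((Homeomorph.addRight (eSeq a n)) ⁻¹' K) = ∅ := by
    rw [← Homeomorph.preimage_interior, hne, Set.preimage_empty]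
  rw [heq, interior_union_isClosed_of_interior_empty hc, hne] at h
  · simp at h
  · rw [interior_union_isClosed_of_interior_empty _ h2, h1]
    exact hc.preimage (Homeomorph.continuous _)

theorem Kset_interior_of_le (ha : ∀ n, 1 ≤ n → 0 < a n ∧ a n < 1)
    {n m : ℕ} (hnm : n ≤ m) (h : (interior (Kset a n)).Nonempty) :
    (interior (Kset a m)).Nonempty := by
  induction m, hnm using Nat.le_induction with
  | base => exact h
  | succ m _ ih => exact Kset_interior_succ ha m ih

/-- Every tail set of large enough level contains an interval. -/
theorem Kset_interval (ha : ∀ n, 1 ≤ n → 0 < a n ∧ a n < 1)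
    {n m : ℕ} (hnm : n ≤ m) (h : (interior (Kset a n)).Nonempty) :
    ∃ u v, u < v ∧ Set.Icc u v ⊆ Kset a m := by
  obtain ⟨x, hx⟩ := Kset_interior_of_le ha hnm h
  rw [mem_interior_iff_mem_nhds, Metric.mem_nhds_iff] at hx
  obtain ⟨ε, hε, hb⟩ := hx
  refine ⟨x, x + ε / 2, by linarith, fun y hy => hb ?_⟩
  rw [Metric.mem_ball, Real.dist_eq, abs_lt]
  constructor <;> linarith [hy.1, hy.2]

end
/-! ### The interval inside the difference set -/

/-- `x` is within `η` of the tail difference set of level `n`. -/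
def Near (a : ℕ → ℝ) (n : ℕ) (η x : ℝ) : Prop := ∃ y ∈ Kset a n, |x - y| ≤ η

section
variable {a : ℕ → ℝ}

theorem Near.neg {n : ℕ} {η x : ℝ} (h : Near a n η x) : Near a n η (-x) := by
  obtain ⟨y, hy, h⟩ := h
  exact ⟨-y, Kset_neg hy, by rw [← abs_neg]; convert h using 2; ring⟩


theorem Near.step (ha : ∀ n, 1 ≤ n → 0 < a n ∧ a n < 1)
    {n : ℕ} {η x : ℝ} (h : Near a (n + 1) η x) : Near a n η x := by
  obtain ⟨y, hy, h⟩ := h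
  exact ⟨y, (mem_Kset_iff ha _ _).2 (Or.inl hy), h⟩

theorem Near.step_sub (ha : ∀ n, 1 ≤ n → 0 < a n ∧ a n < 1)
    {n : ℕ} {η x : ℝ} (h : Near a (n + 1) η (x - eSeq a n)) : Near a n η x := by
  obtain ⟨y, hy, h⟩ := h
  exact ⟨y + eSeq a n, (mem_Kset_iff ha _ _).2 (Or.inr (Or.inl (by simpa using hy))),
    by convert h using 2; ring⟩

theorem block (ha : ∀ n, 1 ≤ n → 0 < a n ∧ a n < 1)
    {j0 K : ℕ} (hj : j0 ≤ K) {R η : ℝ} (hR : 0 ≤ R)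
    (hbase : ∀ x, |x| ≤ dSeq a (K + 1) - R → Near a (K + 1) η x)
    (hcond : ∀ i, j0 ≤ i → i < K →
      2 * R ≤ 3 * dSeq a (i + 1) - dSeq a i - eSeq a K ∧
      2 * R ≤ 4 * dSeq a (K + 1) - (3 * dSeq a (i + 1) - dSeq a i)) :
    ∀ x, |x| ≤ dSeq a j0 - (R + eSeq a K) → Near a j0 η x := by
  have heK : eSeq a K = dSeq a K - dSeq a (K + 1) := rfl
  have heKp := eSeq_pos ha K
  suffices H : (∀ x, 0 ≤ x → x ≤ dSeq a j0 - (R + eSeq a K) → Near a j0 η x) ∧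
      (∀ x, 0 ≤ x → dSeq a j0 - 2 * dSeq a (K + 1) + R ≤ x → x ≤ dSeq a j0 - R →
        Near a j0 η x) by
    intro x hx
    rcases le_total 0 x with h | h
    · exact H.1 x h ((le_abs_self x).trans hx)
    · have := (H.1 (-x) (by linarith) ((neg_le_abs x).trans hx)).neg
      simpa using this
  induction hj using Nat.decreasingInduction with
  | self =>
    constructor
    · intro x h0 hx
      apply Near.step ha
      apply hbase
      rw [abs_of_nonneg h0]; linarith
    · intro x h0 h1 h2
      apply Near.step_sub ha
      apply hbase
      rw [abs_le]
      constructor <;> linarith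
  | of_succ i hi ih =>
    obtain ⟨ih1, ih2⟩ := ih (fun j hj hjK => hcond j (by omega) hjK)
    obtain ⟨c1, c2⟩ := hcond i le_rfl hi
    have hei : eSeq a i = dSeq a i - dSeq a (i + 1) := rfl
    have ih1' : ∀ x, |x| ≤ dSeq a (i + 1) - (R + eSeq a K) → Near a (i + 1) η x := by
      intro x hx
      rcases le_total 0 x with h | h
      · exact ih1 x h ((le_abs_self x).trans hx)
      · have := (ih1 (-x) (by linarith) ((neg_le_abs x).trans hx)).neg
        simpa using this
    have hpi := dSeq_pos ha (i + 1)
    have hdK : 2 * dSeq a (K + 1) < dSeq a (i + 1) := by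
      have h1 := dSeq_half ha K
      have h2 := (dSeq_lt_of_lt ha).antitone (show i + 1 ≤ K from hi)
      linarith
    constructor
    · intro x h0 hx
      by_cases hA : x ≤ dSeq a (i + 1) - (R + eSeq a K)
      · exact Near.step ha (ih1 x h0 hA)
      push Not at hA
      by_cases hB : eSeq a i - (dSeq a (i + 1) - (R + eSeq a K)) ≤ x
      · apply Near.step_sub ha
        apply ih1'
        rw [abs_le]
        constructor <;> linarith
      push Not at hB
      by_cases hC : dSeq a (i + 1) - 2 * dSeq a (K + 1) + R ≤ x
      · exact Near.step ha (ih2 x h0 hC (by linarith))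
      push Not at hC
      apply Near.step_sub ha
      have := (ih2 (eSeq a i - x) (by linarith) (by linarith) (by linarith)).neg
      simpa using this
    · intro x h0 h1 h2
      apply Near.step_sub ha
      rcases le_total 0 (x - eSeq a i) with h | h
      · exact ih2 _ h (by linarith) (by linarith)
      · linarith

end

/-- the summands of `tailSum` -/
noncomputable def epsSeq (a : ℕ → ℝ) (k : ℕ → ℕ) (n : ℕ) : ℝ := dSeq a (k n - 1) - dSeq a (k n)

section
variable {a : ℕ → ℝ} {k : ℕ → ℕ}

theorem epsSeq_nonneg (ha : ∀ n, 1 ≤ n → 0 < a n ∧ a n < 1)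
    (n : ℕ) : 0 ≤ epsSeq a k n :=
  sub_nonneg.2 ((dSeq_lt_of_lt ha).antitone (Nat.sub_le _ _))

theorem epsSeq_succ_le (ha : ∀ n, 1 ≤ n → 0 < a n ∧ a n < 1) (hk : StrictMono k)
    (n : ℕ) : epsSeq a k (n + 1) ≤ dSeq a (k n) - dSeq a (k (n + 1)) := by
  have h1 : k n ≤ k (n + 1) - 1 := Nat.le_sub_one_of_lt (hk (Nat.lt_succ_self n))
  have := (dSeq_lt_of_lt ha).antitone h1
  unfold epsSeq; linarith

theorem epsSeq_sum_le (ha : ∀ n, 1 ≤ n → 0 < a n ∧ a n < 1) (hk : StrictMono k)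
    (n m : ℕ) :
    ∑ i ∈ Finset.range m, epsSeq a k (n + 1 + i) ≤ dSeq a (k n) - dSeq a (k (n + m)) := by
  induction m with
  | zero => simp
  | succ m ih =>
    rw [Finset.sum_range_succ]
    have := epsSeq_succ_le ha hk (n + m)
    rw [show n + 1 + m = n + m + 1 by ring]
    rw [show n + (m + 1) = n + m + 1 by ring]
    linarith

theorem epsSeq_summable (ha : ∀ n, 1 ≤ n → 0 < a n ∧ a n < 1) (hk : StrictMono k)
    (n : ℕ) : Summable (fun i => epsSeq a k (n + 1 + i)) :=
  summable_of_sum_range_le (c := dSeq a (k n)) (fun _ => epsSeq_nonneg ha _) fun m => by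
    have := epsSeq_sum_le ha hk n m
    have := dSeq_pos ha (k (n + m))
    linarith

theorem tailSum_nonneg (ha : ∀ n, 1 ≤ n → 0 < a n ∧ a n < 1)
    (n : ℕ) : 0 ≤ tailSum a k n :=
  tsum_nonneg fun _ => epsSeq_nonneg ha _

theorem tailSum_le (ha : ∀ n, 1 ≤ n → 0 < a n ∧ a n < 1) (hk : StrictMono k)
    (n : ℕ) : tailSum a k n ≤ dSeq a (k n) :=
  (epsSeq_summable ha hk n).tsum_le_of_sum_range_le fun m => by
    have := epsSeq_sum_le ha hk n m
    have := dSeq_pos ha (k (n + m))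
    linarith

theorem tailSum_succ (ha : ∀ n, 1 ≤ n → 0 < a n ∧ a n < 1) (hk : StrictMono k)
    (n : ℕ) : tailSum a k n = tailSum a k (n + 1) + epsSeq a k (n + 1) := by
  have h := (epsSeq_summable ha hk n).tsum_eq_zero_add
  have h1 : tailSum a k n = ∑' i, epsSeq a k (n + 1 + i) := rfl
  have h2 : tailSum a k (n + 1) = ∑' i, epsSeq a k (n + 1 + (i + 1)) := by
    unfold tailSum epsSeq
    apply tsum_congr
    intro i
    rw [show n + 1 + (i + 1) = n + 1 + 1 + i by ring]
  rw [h1, h2, h]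
  simp [add_comm]

theorem tailSum_zero_lt (ha : ∀ n, 1 ≤ n → 0 < a n ∧ a n < 1) (hk : StrictMono k)
    (hk1 : k 0 + 1 < k 1) : tailSum a k 0 < dSeq a (k 0) := by
  rw [tailSum_succ ha hk]
  have h1 := tailSum_le ha hk (0 + 1)
  have h2 : dSeq a (k 1 - 1) < dSeq a (k 0) := dSeq_lt_of_lt ha (by omega)
  simp only [zero_add, epsSeq] at *
  linarith

theorem condStar_real (hs : condStar a k) (n : ℕ) (hn : 1 ≤ n) (i : ℕ)
    (h1 : k (n - 1) + 1 ≤ i) (h2 : i ≤ k n - 1) :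
    2 * tailSum a k n ≤ 3 * dSeq a i - dSeq a (i - 1) - epsSeq a k n ∧
    2 * tailSum a k n ≤ 4 * dSeq a (k n) - (3 * dSeq a i - dSeq a (i - 1)) := by
  have h := hs n hn
  rw [mSeq, le_min_iff] at h
  obtain ⟨ha, hb⟩ := h
  have hmem : ((3 * dSeq a i - dSeq a (i - 1) : ℝ) : EReal) ∈
      ((fun i => ((3 * dSeq a i - dSeq a (i - 1) : ℝ) : EReal)) ''
        (Set.Icc (k (n - 1) + 1) (k n - 1))) := ⟨i, ⟨h1, h2⟩, rfl⟩
  have hd : deltaMin a k n ≤ ((3 * dSeq a i - dSeq a (i - 1) : ℝ) : EReal) := sInf_le hmem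
  have hD : ((3 * dSeq a i - dSeq a (i - 1) : ℝ) : EReal) ≤ deltaMax a k n := le_sSup hmem
  have h3 := ha.trans (EReal.sub_le_sub hd le_rfl)
  have h4 := hb.trans (EReal.sub_le_sub le_rfl hD)
  rw [← EReal.coe_sub, EReal.coe_le_coe_iff] at h3 h4
  exact ⟨h3, h4⟩

theorem near_all (ha : ∀ n, 1 ≤ n → 0 < a n ∧ a n < 1) (hk : StrictMono k)
    (hs : condStar a k) (M m : ℕ) (hm : m ≤ M) :
    ∀ x, |x| ≤ dSeq a (k m) - tailSum a k m → Near a (k m) (dSeq a (k M)) x := by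
  induction hm using Nat.decreasingInduction with
  | self =>
    intro x hx
    refine ⟨0, zero_mem_Kset _, ?_⟩
    have := tailSum_nonneg (k := k) ha M
    rw [sub_zero]; linarith
  | of_succ m hm ih =>
    have hlt : k m < k (m + 1) := hk (Nat.lt_succ_self m)
    obtain ⟨K, hK⟩ : ∃ K, k (m + 1) = K + 1 := ⟨k (m + 1) - 1, by omega⟩
    have heps : epsSeq a k (m + 1) = eSeq a K := by simp [epsSeq, eSeq, hK]
    rw [tailSum_succ ha hk, heps]
    apply block ha (by omega) (tailSum_nonneg ha (m + 1))
    · rw [← hK]; exact ih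
    · intro i hi hiK
      have := condStar_real hs (m + 1) (by omega) (i + 1) (by simpa using hi) (by omega)
      rw [heps, hK] at this
      simpa using this

theorem Kset_interior (ha : ∀ n, 1 ≤ n → 0 < a n ∧ a n < 1) (hk : StrictMono k)
    (hs : condStar a k) (hk1 : k 0 + 1 < k 1) :
    (interior (Kset a (k 0))).Nonempty := by
  have hlt := tailSum_zero_lt ha hk hk1
  set b := dSeq a (k 0) - tailSum a k 0 with hb
  have hbp : 0 < b := by linarith
  refine ⟨0, ?_⟩
  rw [mem_interior_iff_mem_nhds, Metric.mem_nhds_iff]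
  refine ⟨b, hbp, fun x hx => ?_⟩
  rw [Metric.mem_ball, Real.dist_eq, sub_zero] at hx
  rw [← (Kset_closed ha (k 0)).closure_eq, Metric.mem_closure_iff]
  intro ε hε
  obtain ⟨M, hM⟩ :=
    (((dSeq_tendsto ha).comp hk.tendsto_atTop).eventually (gt_mem_nhds hε)).exists
  obtain ⟨y, hy, hxy⟩ := near_all ha hk hs M 0 (Nat.zero_le _) x hx.le
  exact ⟨y, hy, lt_of_le_of_lt hxy hM⟩

end
/-! ### Gaps and components -/

/-- `(p, q)` is a gap of `E`. -/
def GapPair (E : Set ℝ) (p q : ℝ) : Prop :=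
  p < q ∧ p ∈ E ∧ q ∈ E ∧ ∀ x, p < x → x < q → x ∉ E

theorem GapPair.component {E : Set ℝ} {p q : ℝ} (h : GapPair E p q) {x : ℝ}
    (hx : x ∈ Set.Ioo p q) : connectedComponentIn Eᶜ x = Set.Ioo p q := by
  obtain ⟨hpq, hp, hq, hE⟩ := h
  have hxE : x ∈ Eᶜ := hE x hx.1 hx.2
  apply Set.Subset.antisymm
  · intro y hy
    have hoc := (isPreconnected_connectedComponentIn (F := Eᶜ) (x := x)).ordConnected
    have hxm := mem_connectedComponentIn hxE
    have hsub := connectedComponentIn_subset Eᶜ x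
    constructor
    · by_contra hc
      push Not at hc
      exact hsub (hoc.out hy hxm ⟨hc, hx.1.le⟩) hp
    · by_contra hc
      push Not at hc
      exact hsub (hoc.out hxm hy ⟨hx.2.le, hc⟩) hq
  · exact isPreconnected_Ioo.subset_connectedComponentIn hx fun y hy => hE y hy.1 hy.2

theorem GapPair.isGapOf {E : Set ℝ} {p q : ℝ} (h : GapPair E p q) : IsGapOf E (Set.Ioo p q) := by
  have hm : (p + q) / 2 ∈ Set.Ioo p q := ⟨by linarith [h.1], by linarith [h.1]⟩
  exact ⟨⟨_, h.2.2.2 _ hm.1 hm.2, (h.component hm).symm⟩, Metric.isBounded_Ioo p q⟩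

theorem IsGapOf.exists_pair {E G : Set ℝ} (hE : IsClosed E) (h : IsGapOf E G) :
    ∃ p q, GapPair E p q ∧ G = Set.Ioo p q := by
  obtain ⟨⟨x, hx, rfl⟩, hb⟩ := h
  have h1 : (E ∩ Set.Iic x).Nonempty := by
    by_contra hne
    rw [Set.not_nonempty_iff_eq_empty] at hne
    have hs : Set.Iic x ⊆ Eᶜ := fun y hy hyE => by
      have : y ∈ E ∩ Set.Iic x := ⟨hyE, hy⟩
      rw [hne] at this; exact this
    have := isPreconnected_Iic.subset_connectedComponentIn (Set.mem_Iic.2 le_rfl) hs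
    exact not_bddBelow_Iic x ((hb.subset this).bddBelow)
  have h2 : (E ∩ Set.Ici x).Nonempty := by
    by_contra hne
    rw [Set.not_nonempty_iff_eq_empty] at hne
    have hs : Set.Ici x ⊆ Eᶜ := fun y hy hyE => by
      have : y ∈ E ∩ Set.Ici x := ⟨hyE, hy⟩
      rw [hne] at this; exact this
    have := isPreconnected_Ici.subset_connectedComponentIn (Set.mem_Ici.2 le_rfl) hs
    exact not_bddAbove_Ici x ((hb.subset this).bddAbove)
  have b1 : BddAbove (E ∩ Set.Iic x) := ⟨x, fun y hy => hy.2⟩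
  have b2 : BddBelow (E ∩ Set.Ici x) := ⟨x, fun y hy => hy.2⟩
  have m1 := (hE.inter isClosed_Iic).csSup_mem h1 b1
  have m2 := (hE.inter isClosed_Ici).csInf_mem h2 b2
  set p := sSup (E ∩ Set.Iic x)
  set q := sInf (E ∩ Set.Ici x)
  have hpx : p < x := lt_of_le_of_ne m1.2 fun h => hx (h ▸ m1.1)
  have hxq : x < q := lt_of_le_of_ne m2.2 fun h => hx (h ▸ m2.1)
  have hp : GapPair E p q := by
    refine ⟨hpx.trans hxq, m1.1, m2.1, fun y hy1 hy2 hyE => ?_⟩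
    rcases le_total y x with h | h
    · exact absurd (le_csSup b1 ⟨hyE, h⟩) (not_le.2 hy1)
    · exact absurd (csInf_le b2 ⟨hyE, h⟩) (not_le.2 hy2)
  exact ⟨p, q, hp, hp.component ⟨hpx, hxq⟩⟩

/-- An interval in `E` enclosed by two points outside `E`. -/
theorem exists_component {E : Set ℝ} {z u v w : ℝ} (huv : u < v) (hs : Set.Icc u v ⊆ E)
    (hzu : z < u) (hz : z ∉ E) (hvw : v < w) (hw : w ∉ E) :
    ∃ C, IsProperComponentOf E C ∧ C ⊆ Set.Ioo z w := by
  have hu : u ∈ E := hs ⟨le_rfl, huv.le⟩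
  refine ⟨connectedComponentIn E u, ⟨⟨u, hu, rfl⟩, ?_⟩, ?_⟩
  · have := isPreconnected_Icc.subset_connectedComponentIn (Set.left_mem_Icc.2 huv.le) hs
    exact ⟨u, this (Set.left_mem_Icc.2 huv.le), v, this (Set.right_mem_Icc.2 huv.le), huv.ne⟩
  · intro y hy
    have hoc := (isPreconnected_connectedComponentIn (F := E) (x := u)).ordConnected
    have hum := mem_connectedComponentIn hu
    have hsub := connectedComponentIn_subset E u
    constructor
    · by_contra hc
      push Not at hc
      exact hz (hsub (hoc.out hy hum ⟨hc, hzu.le⟩))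
    · by_contra hc
      push Not at hc
      exact hw (hsub (hoc.out hum hy ⟨(huv.trans hvw).le, hc⟩))

/-- The gap to the right of `p` is accumulated at `p` by gaps and intervals. -/
def LeftAcc (E : Set ℝ) (p : ℝ) : Prop := ∀ ε > 0,
  (∃ p' q', GapPair E p' q' ∧ p - ε < p' ∧ q' ≤ p) ∧
  ∃ z u v w, p - ε < z ∧ z < u ∧ u < v ∧ v < w ∧ w < p + ε ∧ z ∉ E ∧ w ∉ E ∧ Set.Icc u v ⊆ E

section
variable {a : ℕ → ℝ}

/-- Near the left end of a gap the difference set looks like the right end of `K_n`. -/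
theorem local_structure (ha : ∀ n, 1 ≤ n → 0 < a n ∧ a n < 1)
    {p q : ℝ} (h : GapPair (Kset a 0) p q) :
    ∃ n f η, 0 < η ∧ p = f + dSeq a n ∧ (∀ y ∈ Kset a n, f + y ∈ Kset a 0) ∧
      ∀ x ∈ Kset a 0, p - η < x → x ≤ p → x - f ∈ Kset a n := by
  obtain ⟨hpq, hp, hq, hE⟩ := h
  obtain ⟨n, hn⟩ := ((dSeq_tendsto ha).eventually
    (gt_mem_nhds (show 0 < (q - p) / 2 by linarith))).exists
  obtain ⟨F, hF, hdec⟩ := Kset_decomp ha n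
  have hmem : ∀ g ∈ F, ∀ y ∈ Kset a n, g + y ∈ Kset a 0 := fun g hg y hy =>
    (hdec _).2 ⟨g, hg, by simpa using hy⟩
  have hside : ∀ g ∈ F, g - dSeq a n ≤ p → g + dSeq a n ≤ p := by
    intro g hg hgp
    by_contra hc
    push Not at hc
    have h1 := hmem g hg _ (d_mem_Kset ha n)
    have : q ≤ g + dSeq a n := by
      by_contra hc2
      push Not at hc2
      exact hE _ hc hc2 h1
    linarith
  obtain ⟨f, hf, hpf⟩ := (hdec p).1 hp
  have hb := Kset_bd ha hpf
  have hpe : p = f + dSeq a n := le_antisymm (by linarith) (hside f hf (by linarith))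
  have hfin : ((fun g => g + dSeq a n) '' F \ {p}).Finite := (hF.image _).sdiff
  have hnh : ((fun g => g + dSeq a n) '' F \ {p})ᶜ ∈ nhds p :=
    hfin.isClosed.isOpen_compl.mem_nhds (by simp)
  obtain ⟨η, hη, hball⟩ := Metric.mem_nhds_iff.1 hnh
  refine ⟨n, f, η, hη, hpe, hmem f hf, fun x hx hx1 hx2 => ?_⟩
  obtain ⟨g, hg, hxg⟩ := (hdec x).1 hx
  have hb := Kset_bd ha hxg
  have h1 := hside g hg (by linarith)
  have h2 : g + dSeq a n = p := by
    by_contra hne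
    have : g + dSeq a n ∈ Metric.ball p η := by
      rw [Metric.mem_ball, Real.dist_eq, abs_lt]
      constructor <;> linarith
    exact hball this ⟨⟨g, hg, rfl⟩, hne⟩
  have : g = f := by linarith
  rwa [this] at hxg

theorem leftAcc (ha : ∀ n, 1 ≤ n → 0 < a n ∧ a n < 1)
    {p q : ℝ} (h : GapPair (Kset a 0) p q) {n0 : ℕ}
    (hint : (interior (Kset a n0)).Nonempty)
    (hgap : ∀ n, ∃ N, n ≤ N ∧ 3 * dSeq a (N + 1) < dSeq a N) : LeftAcc (Kset a 0) p := by
  obtain ⟨n, f, η, hη, hpe, hmem, hloc⟩ := local_structure ha h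
  intro ε hε
  obtain ⟨N0, hN0⟩ := Filter.eventually_atTop.1 ((dSeq_tendsto ha).eventually
    (gt_mem_nhds (show 0 < min ε η by positivity)))
  obtain ⟨N, hN, hgN⟩ := hgap (max N0 (max n n0))
  have hN1 : N0 ≤ N := (le_max_left _ _).trans hN
  have hN2 : n ≤ N := ((le_max_left _ _).trans (le_max_right _ _)).trans hN
  have hN3 : n0 ≤ N := ((le_max_right _ _).trans (le_max_right _ _)).trans hN
  have hdN := hN0 N hN1
  have hdε : dSeq a N < ε := hdN.trans_le (min_le_left _ _)
  have hdη : dSeq a N < η := hdN.trans_le (min_le_right _ _)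
  have hpos := dSeq_pos ha (N + 1)
  have heN : eSeq a N = dSeq a N - dSeq a (N + 1) := rfl
  have hempty : ∀ x, p - eSeq a N < x → x < p - 2 * dSeq a (N + 1) → x ∉ Kset a 0 := by
    intro x h1 h2 hx
    have := hloc x hx (by linarith) (by linarith)
    rcases Kset_gap ha hN2 this with h | h <;> linarith
  have hgp : GapPair (Kset a 0) (p - eSeq a N) (p - 2 * dSeq a (N + 1)) := by
    refine ⟨by linarith, ?_, ?_, hempty⟩
    · have h1 : dSeq a (N + 1) ∈ Kset a N :=
        (mem_Kset_iff ha _ _).2 (Or.inl (d_mem_Kset ha (N + 1)))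
      convert hmem _ (Kset_right ha hN2 h1) using 1
      linarith
    · have h1 : -dSeq a (N + 1) ∈ Kset a (N + 1) := Kset_neg (d_mem_Kset ha (N + 1))
      convert hmem _ (Kset_right ha (hN2.trans (Nat.le_succ N)) h1) using 1
      linarith
  refine ⟨⟨_, _, hgp, by linarith, by linarith⟩, ?_⟩
  obtain ⟨u, v, huv, hsub⟩ := Kset_interval ha (hN3.trans (Nat.le_succ N)) hint
  have hbu := Kset_bd ha (hsub (Set.left_mem_Icc.2 huv.le))
  have hbv := Kset_bd ha (hsub (Set.right_mem_Icc.2 huv.le))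
  have hpq := h.1
  have hm1 : 0 < min (q - p) ε := lt_min (by linarith) hε
  have hm2 := min_le_left (q - p) ε
  have hm3 := min_le_right (q - p) ε
  refine ⟨p - (eSeq a N + 2 * dSeq a (N + 1)) / 2, p - dSeq a (N + 1) + u, p - dSeq a (N + 1) + v,
    p + min (q - p) ε / 2, by linarith, by linarith, by linarith, by linarith, by linarith,
    hempty _ (by linarith) (by linarith), h.2.2.2 _ (by linarith) (by linarith), ?_⟩
  intro x hx
  have h1 : x - (p - dSeq a (N + 1)) ∈ Kset a (N + 1) :=
    hsub ⟨by linarith [hx.1], by linarith [hx.2]⟩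
  convert hmem _ (Kset_right ha (hN2.trans (Nat.le_succ N)) h1) using 1
  linarith

theorem Kset_perfect (ha : ∀ n, 1 ≤ n → 0 < a n ∧ a n < 1)
    : Perfect (Kset a 0) := by
  refine ⟨Kset_closed ha 0, fun x hx => ?_⟩
  rw [accPt_iff_nhds]
  intro U hU
  obtain ⟨ε, hε, hball⟩ := Metric.mem_nhds_iff.1 hU
  obtain ⟨n, hn⟩ := ((dSeq_tendsto ha).eventually
    (gt_mem_nhds (show 0 < ε / 2 by linarith))).exists
  obtain ⟨F, hF, hdec⟩ := Kset_decomp ha n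
  obtain ⟨f, hf, hxf⟩ := (hdec x).1 hx
  have hb := Kset_bd ha hxf
  have hpos := dSeq_pos ha n
  have h1 : f + dSeq a n ∈ Kset a 0 := (hdec _).2 ⟨f, hf, by simpa using d_mem_Kset ha n⟩
  have h2 : f - dSeq a n ∈ Kset a 0 :=
    (hdec _).2 ⟨f, hf, by simpa using Kset_neg (d_mem_Kset ha n)⟩
  by_cases hc : x = f + dSeq a n
  · refine ⟨f - dSeq a n, ⟨hball ?_, h2⟩, by linarith⟩
    rw [Metric.mem_ball, Real.dist_eq, abs_lt]
    constructor <;> linarith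
  · refine ⟨f + dSeq a n, ⟨hball ?_, h1⟩, fun h => hc h.symm⟩
    rw [Metric.mem_ball, Real.dist_eq, abs_lt]
    constructor <;> linarith

theorem Kset_infinite_gaps (ha : ∀ n, 1 ≤ n → 0 < a n ∧ a n < 1)
    (hgap : ∀ n, ∃ N, n ≤ N ∧ 3 * dSeq a (N + 1) < dSeq a N) :
    {G : Set ℝ | IsGapOf (Kset a 0) G}.Infinite := by
  have hinf : {N : ℕ | 3 * dSeq a (N + 1) < dSeq a N}.Infinite :=
    Set.infinite_of_forall_exists_gt fun n => by
      obtain ⟨N, h1, h2⟩ := hgap (n + 1)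
      exact ⟨N, h2, h1⟩
  have hpair : ∀ N, 3 * dSeq a (N + 1) < dSeq a N →
      GapPair (Kset a 0) (dSeq a 0 - eSeq a N) (dSeq a 0 - 2 * dSeq a (N + 1)) := by
    intro N hgN
    have heN : eSeq a N = dSeq a N - dSeq a (N + 1) := rfl
    refine ⟨by linarith, ?_, ?_, fun x h1 h2 hx => ?_⟩
    · have h1 : dSeq a (N + 1) ∈ Kset a N :=
        (mem_Kset_iff ha _ _).2 (Or.inl (d_mem_Kset ha (N + 1)))
      convert Kset_right ha (Nat.zero_le N) h1 using 1
      linarith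
    · have h1 : -dSeq a (N + 1) ∈ Kset a (N + 1) := Kset_neg (d_mem_Kset ha (N + 1))
      convert Kset_right ha (Nat.zero_le (N + 1)) h1 using 1
      linarith
    · rcases Kset_gap ha (Nat.zero_le N) hx with h | h <;> linarith
  refine Set.infinite_of_injOn_mapsTo
    (f := fun N => Set.Ioo (dSeq a 0 - eSeq a N) (dSeq a 0 - 2 * dSeq a (N + 1)))
    ?_ (fun N hN => (hpair N hN).isGapOf) hinf
  intro N hN M hM hNM
  have h1 := congrArg sSup hNM
  simp only at h1
  rw [csSup_Ioo (hpair N hN).1, csSup_Ioo (hpair M hM).1] at h1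
  have h2 : dSeq a (N + 1) = dSeq a (M + 1) := by linarith
  have := (dSeq_lt_of_lt ha).injective h2
  omega

end

theorem GapPair.neg {a : ℕ → ℝ} {p q : ℝ} (h : GapPair (Kset a 0) p q) :
    GapPair (Kset a 0) (-q) (-p) :=
  ⟨neg_lt_neg h.1, Kset_neg h.2.2.1, Kset_neg h.2.1, fun x h1 h2 hx =>
    h.2.2.2 (-x) (by linarith) (by linarith) (Kset_neg hx)⟩

/-- If `{n : aₙ > 1/3}` is infinite, `a_{k₀+1} < 1/3` and condition `(*)` holds,
then `C(a) - C(a)` is a Cantorval. -/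
theorem cantorval_of_condStar (a : ℕ → ℝ) (k : ℕ → ℕ)
    (ha : ∀ n, 1 ≤ n → 0 < a n ∧ a n < 1)
    (hinf : {n : ℕ | 1 ≤ n ∧ 1 / 3 < a n}.Infinite)
    (hk0 : a (k 0 + 1) < 1 / 3)
    (hk : IsGapEnum a k)
    (hstar : condStar a k) :
    IsCantorval (cantorSet a - cantorSet a) := by
  have hgap : ∀ n, ∃ N, n ≤ N ∧ 3 * dSeq a (N + 1) < dSeq a N := by
    intro n
    obtain ⟨N, ⟨h1, h2⟩, hlt⟩ := hinf.exists_gt n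
    obtain ⟨M, rfl⟩ : ∃ M, N = M + 1 := ⟨N - 1, by omega⟩
    refine ⟨M, by omega, ?_⟩
    rw [dSeq_succ]
    have := dSeq_pos ha M
    nlinarith
  have hk1 : k 0 + 1 < k 1 := by
    have h1 := hk.1 (show 0 < 1 by norm_num)
    have h2 := (hk.2.1 1 le_rfl).2
    rcases Nat.lt_or_ge (k 0 + 1) (k 1) with h | h
    · exact h
    · have : k 1 = k 0 + 1 := by omega
      rw [this] at h2
      linarith
  have hint := Kset_interior ha hk.1 hstar hk1
  rw [cantorSet_eq ha]
  change IsCantorval (Kset a 0)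
  refine ⟨Kset_perfect ha, Kset_infinite_gaps ha hgap, ?_⟩
  intro G hG
  obtain ⟨p, q, hpq, rfl⟩ := IsGapOf.exists_pair (Kset_closed ha 0) hG
  rintro r (rfl | rfl)
  · rw [csInf_Ioo hpq.1]
    have hacc := leftAcc ha hpq hint hgap
    refine ⟨fun ε hε => ?_, fun ε hε => ?_⟩
    · obtain ⟨⟨p', q', h1, h2, h3⟩, -⟩ := hacc ε hε
      refine ⟨_, h1.isGapOf, ?_, fun x hx => ⟨by linarith [hx.1], by linarith [hx.2]⟩⟩
      intro he
      have := congrArg sSup he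
      rw [csSup_Ioo hpq.1, csSup_Ioo h1.1] at this
      linarith [hpq.1]
    · obtain ⟨-, z, u, v, w, h1, h2, h3, h4, h5, h6, h7, h8⟩ := hacc ε hε
      obtain ⟨C, hC, hs⟩ := exists_component h3 h8 h2 h6 h4 h7
      exact ⟨C, hC, fun x hx => ⟨by linarith [(hs hx).1], by linarith [(hs hx).2]⟩⟩
  · rw [csSup_Ioo hpq.1]
    have hacc := leftAcc ha hpq.neg hint hgap
    refine ⟨fun ε hε => ?_, fun ε hε => ?_⟩
    · obtain ⟨⟨p', q', h1, h2, h3⟩, -⟩ := hacc ε hε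
      refine ⟨_, h1.neg.isGapOf, ?_, fun x hx => ⟨by linarith [hx.1], by linarith [hx.2]⟩⟩
      intro he
      have := congrArg sInf he
      rw [csInf_Ioo hpq.1, csInf_Ioo h1.neg.1] at this
      linarith [hpq.1]
    · obtain ⟨-, z, u, v, w, h1, h2, h3, h4, h5, h6, h7, h8⟩ := hacc ε hε
      have h8' : Set.Icc (-v) (-u) ⊆ Kset a 0 := fun x hx => by
        have := Kset_neg (h8 (show -x ∈ Set.Icc u v from
          ⟨by linarith [hx.2], by linarith [hx.1]⟩))
        simpa using this
      have h6' : -z ∉ Kset a 0 := fun h => h6 (by simpa using Kset_neg h)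
      have h7' : -w ∉ Kset a 0 := fun h => h7 (by simpa using Kset_neg h)
      obtain ⟨C, hC, hs⟩ := exists_component (neg_lt_neg h3) h8' (neg_lt_neg h4) h7'
        (neg_lt_neg h2) h6'
      exact ⟨C, hC, fun x hx => ⟨by linarith [(hs hx).1], by linarith [(hs hx).2]⟩⟩
end CCS
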